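/- arXiv:math/0602460 — 2 statements merged into one kernel-verified Lean document; each statement's English description precedes it below -/
import Mathlib

section
/- If B ⊂ ℝ^d is closed and B ∩ K_c^δ = ∅, then the set B_c = {x + ct : x ∈ B, t ≥ 0} is closed. Moreover, if B ⊂ ℝ^d is open, then B_c is open. -/
open Filter Topology

section ConeShift

open scoped Pointwise

variable {E : Type*} [NormedAddCommGroup E] [NormedSpace ℝ E]

/-- The ray shift of `B` in direction `c` is the Minkowski sum of `B` and the ray through `c`. -/
theorem setOf_exists_add_smul_eq (B : Set E) (c : E) :
    {y : E | ∃ x ∈ B, ∃ t : ℝ, 0 ≤ t ∧ y = x + t • c} =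
      B + (fun t : ℝ => t • c) '' Set.Ici 0 := by
  ext y
  simp [Set.mem_add, eq_comm]

/-- A neighbourhood of `-c` that is invariant under positive scaling contains `y - t • c` for all
large `t`, locally uniformly in `y`. -/
theorem eventually_sub_smul_mem {c : E} {K : Set E} (hK : K ∈ 𝓝 (-c))
    (hsmul : ∀ r : ℝ, 0 < r → ∀ x ∈ K, r • x ∈ K) (y : E) :
    ∀ᶠ p : E × ℝ in 𝓝 y ×ˢ atTop, p.1 - p.2 • c ∈ K := by
  have hlim : Tendsto (fun p : E × ℝ => p.2⁻¹ • p.1 - c) (𝓝 y ×ˢ atTop) (𝓝 (-c)) := by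
    simpa using (((tendsto_inv_atTop_zero (𝕜 := ℝ)).comp tendsto_snd).smul tendsto_fst).sub_const c
  filter_upwards [hlim.eventually hK, tendsto_snd.eventually (eventually_gt_atTop (0 : ℝ))]
    with p hp hpos
  simpa [smul_sub, smul_smul, hpos.ne'] using hsmul p.2 hpos _ hp

/-- Adding the ray through `c` to a closed set that avoids a conic neighbourhood of `-c` gives a
closed set. -/
theorem IsClosed.add_ray {c : E} {B K : Set E} (hB : IsClosed B) (hK : K ∈ 𝓝 (-c))
    (hsmul : ∀ r : ℝ, 0 < r → ∀ x ∈ K, r • x ∈ K) (hBK : Disjoint B K) :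
    IsClosed (B + (fun t : ℝ => t • c) '' Set.Ici 0) := by
  refine isClosed_of_closure_subset fun y hy => ?_
  obtain ⟨U, hU, V, hV, hUV⟩ := mem_prod_iff.1 (eventually_sub_smul_mem hK hsmul y)
  obtain ⟨T, hT⟩ := mem_atTop_sets.1 hV
  have hsub : (B + (fun t : ℝ => t • c) '' Set.Ici 0) ∩ U ⊆
      B + (fun t : ℝ => t • c) '' Set.Icc 0 T := by
    rintro _ ⟨⟨x, hx, _, ⟨t, ht, rfl⟩, rfl⟩, hxU⟩
    refine Set.add_mem_add hx (Set.mem_image_of_mem _ ⟨ht, ?_⟩)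
    by_contra! hlt
    have hxK : x + t • c - t • c ∈ K := hUV (Set.mk_mem_prod hxU (hT t hlt.le))
    exact Set.disjoint_left.1 hBK hx (by simpa using hxK)
  have hclosed : IsClosed (B + (fun t : ℝ => t • c) '' Set.Icc 0 T) :=
    hB.add_right_of_isCompact (isCompact_Icc.image (by fun_prop))
  have hyU : y ∈ closure ((B + (fun t : ℝ => t • c) '' Set.Ici 0) ∩ U) := by
    rw [mem_closure_iff_nhdsWithin_neBot] at hy ⊢
    rwa [nhdsWithin_inter_of_mem' (mem_nhdsWithin_of_mem_nhds hU)]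
  exact Set.add_subset_add_left (Set.image_mono Set.Icc_subset_Ici_self)
    (closure_minimal hsub hclosed hyU)

theorem directionCone_mem_nhds {c : E} (hc : c ≠ 0) {δ : ℝ} (hδ : 0 < δ) :
    {x : E | x ≠ 0 ∧ ‖‖x‖⁻¹ • x + ‖c‖⁻¹ • c‖ < δ} ∈ 𝓝 (-c) := by
  have hcont : ContinuousAt (fun x : E => ‖‖x‖⁻¹ • x + ‖c‖⁻¹ • c‖) (-c) :=
    (((continuousAt_id.norm.inv₀ (by simpa using hc)).smul continuousAt_id).add
      continuousAt_const).norm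
  exact (eventually_ne_nhds (neg_ne_zero.2 hc)).and
    (hcont.eventually_lt continuousAt_const (by simpa using hδ))

theorem smul_mem_directionCone (c : E) (δ : ℝ) (r : ℝ) (hr : 0 < r) (x : E)
    (hx : x ∈ {x : E | x ≠ 0 ∧ ‖‖x‖⁻¹ • x + ‖c‖⁻¹ • c‖ < δ}) :
    r • x ∈ {x : E | x ≠ 0 ∧ ‖‖x‖⁻¹ • x + ‖c‖⁻¹ • c‖ < δ} := by
  refine ⟨smul_ne_zero hr.ne' hx.1, ?_⟩
  have hnormalize : ‖r • x‖⁻¹ • r • x = ‖x‖⁻¹ • x := by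
    rw [norm_smul, Real.norm_of_nonneg hr.le, smul_smul, mul_inv_rev, mul_assoc,
      inv_mul_cancel₀ hr.ne', mul_one]
  rw [hnormalize]
  exact hx.2

end ConeShift

/-- If `B ⊆ ℝ^d` is closed and disjoint from the cone
`K_c^δ = {x ≠ 0 : |x/|x| + c/|c|| < δ}`, then `B_c = {x + ct : x ∈ B, t ≥ 0}` is closed;
moreover, if `B` is open then `B_c` is open. -/
theorem coneShift_closed_and_open
    {d : ℕ} (c : EuclideanSpace ℝ (Fin d)) (hc : c ≠ 0) (δ : ℝ) (hδ : 0 < δ) :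
    (∀ B : Set (EuclideanSpace ℝ (Fin d)), IsClosed B →
      B ∩ {x : EuclideanSpace ℝ (Fin d) | x ≠ 0 ∧ ‖‖x‖⁻¹ • x + ‖c‖⁻¹ • c‖ < δ} = ∅ →
      IsClosed {y : EuclideanSpace ℝ (Fin d) | ∃ x ∈ B, ∃ t : ℝ, 0 ≤ t ∧ y = x + t • c}) ∧
    (∀ B : Set (EuclideanSpace ℝ (Fin d)), IsOpen B →
      IsOpen {y : EuclideanSpace ℝ (Fin d) | ∃ x ∈ B, ∃ t : ℝ, 0 ≤ t ∧ y = x + t • c}) := by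
  simp only [setOf_exists_add_smul_eq]
  exact ⟨fun B hB hBK => hB.add_ray (directionCone_mem_nhds hc hδ) (smul_mem_directionCone c δ)
    (Set.disjoint_iff_inter_eq_empty.2 hBK), fun B hB => hB.add_right⟩
end

section
/- Let c ∈ ℝ^d, c ≠ 0, δ ∈ (0, 2), and let A ⊂ ℝ^d be bounded away from 0 and such that, for all sufficiently small ε > 0, the set A^ε = {y ∈ ℝ^d : |x − y| ≤ ε for some x ∈ A} satisfies A^ε ∩ K_c^{δ/2} = ∅. Then for every v > 0 and every y_0 ∈ ℝ^d: if for every ε > 0 there exists t ≥ v with y_0 ∈ ct + A^ε, then there exists t_* ≥ v with y_0 ∈ ct_* + cl(A). -/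
open Filter Topology

/-- The direction of `y - t • c` tends to that of `-c` as `t → ∞`. -/
lemma tendsto_direction_sub_smul {E : Type*} [NormedAddCommGroup E] [NormedSpace ℝ E]
    {c : E} (hc : c ≠ 0) (y : E) :
    Tendsto (fun t : ℝ => ‖y - t • c‖⁻¹ • (y - t • c)) atTop (𝓝 (-(‖c‖⁻¹ • c))) := by
  have h : Tendsto (fun t : ℝ => t⁻¹ • y - c) atTop (𝓝 (-c)) := by
    simpa using ((tendsto_inv_atTop_zero (𝕜 := ℝ)).smul_const y).sub_const c
  have hdir : Tendsto (fun t : ℝ => ‖t⁻¹ • y - c‖⁻¹ • (t⁻¹ • y - c)) atTop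
      (𝓝 (-(‖c‖⁻¹ • c))) := by
    simpa using (h.norm.inv₀ (by simpa using hc)).smul h
  refine hdir.congr' ?_
  filter_upwards [eventually_gt_atTop 0] with t ht
  have hy : y - t • c = t • (t⁻¹ • y - c) := by
    rw [smul_sub, smul_inv_smul₀ ht.ne']
  rw [hy, norm_smul, Real.norm_of_nonneg ht.le, smul_smul, mul_inv_rev, mul_assoc,
    inv_mul_cancel₀ ht.ne', mul_one]

/-- For large `t`, the point `y - t • c` lies in the cone of opening `η` around `-c`. -/
lemma eventually_sub_smul_mem_cone {E : Type*} [NormedAddCommGroup E] [NormedSpace ℝ E]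
    {c : E} (hc : c ≠ 0) (y : E) {η : ℝ} (hη : 0 < η) :
    ∀ᶠ t : ℝ in atTop, y - t • c ≠ 0 ∧
      ‖‖y - t • c‖⁻¹ • (y - t • c) + ‖c‖⁻¹ • c‖ < η := by
  have h := tendsto_direction_sub_smul hc y
  have hne : -(‖c‖⁻¹ • c) ≠ 0 := by simpa using hc
  filter_upwards [h.eventually_ne hne, h.eventually (Metric.ball_mem_nhds _ hη)] with t h0 hlt
  refine ⟨fun hz => h0 (by simp [hz]), ?_⟩
  simpa [dist_eq_norm] using hlt

/-- Let `c ≠ 0`, `δ ∈ (0,2)`, and let `A` be bounded away from `0` such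
that, for all sufficiently small `ε > 0`, the `ε`-fattening
`A^ε = {y : ∃ x ∈ A, |x − y| ≤ ε}` is disjoint from `K_c^{δ/2}`. If `y₀ ∈ ct + A^ε` with
some `t ≥ v` for every `ε > 0`, then `y₀ ∈ ct_* + cl(A)` for some `t_* ≥ v`. -/
theorem shifted_fattening_limit
    {d : ℕ} (c : EuclideanSpace ℝ (Fin d)) (hc : c ≠ 0) (δ : ℝ) (hδ0 : 0 < δ) (hδ2 : δ < 2)
    (A : Set (EuclideanSpace ℝ (Fin d)))
    (hAbdd : (0 : EuclideanSpace ℝ (Fin d)) ∉ closure A)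
    (hsep : ∃ ε₀ : ℝ, 0 < ε₀ ∧ ∀ ε : ℝ, 0 < ε → ε ≤ ε₀ →
      {y : EuclideanSpace ℝ (Fin d) | ∃ x ∈ A, ‖x - y‖ ≤ ε} ∩
        {x : EuclideanSpace ℝ (Fin d) | x ≠ 0 ∧ ‖‖x‖⁻¹ • x + ‖c‖⁻¹ • c‖ < δ / 2} = ∅) :
    ∀ v : ℝ, 0 < v → ∀ y₀ : EuclideanSpace ℝ (Fin d),
      (∀ ε : ℝ, 0 < ε → ∃ t : ℝ, v ≤ t ∧ y₀ - t • c ∈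
        {y : EuclideanSpace ℝ (Fin d) | ∃ x ∈ A, ‖x - y‖ ≤ ε}) →
      ∃ t : ℝ, v ≤ t ∧ y₀ - t • c ∈ closure A := by
  intro v _ y₀ hy
  obtain ⟨ε₀, hε₀, hsep⟩ := hsep
  obtain ⟨T, hT⟩ := eventually_atTop.1 (eventually_sub_smul_mem_cone hc y₀ (half_pos hδ0))
  have hbound : ∀ ε : ℝ, 0 < ε → ε ≤ ε₀ →
      ∃ t ∈ Set.Icc v T, ∃ x ∈ A, ‖x - (y₀ - t • c)‖ ≤ ε := by
    intro ε hε hle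
    obtain ⟨t, hvt, hmem⟩ := hy ε hε
    refine ⟨t, ⟨hvt, ?_⟩, hmem⟩
    by_contra! hTt
    exact (hsep ε hε hle).subset ⟨hmem, hT t hTt.le⟩
  obtain ⟨t₀, ht₀, x₀, hx₀, -⟩ := hbound ε₀ hε₀ le_rfl
  have hcont : Continuous fun t : ℝ => Metric.infDist (y₀ - t • c) A :=
    (Metric.continuous_infDist_pt A).comp (by fun_prop)
  obtain ⟨s, hs, hmin⟩ := isCompact_Icc.exists_isMinOn ⟨t₀, ht₀⟩ hcont.continuousOn
  refine ⟨s, hs.1, (Metric.mem_closure_iff_infDist_zero ⟨x₀, hx₀⟩).2 ?_⟩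
  refine le_antisymm (le_of_forall_pos_le_add fun ε hε => ?_) Metric.infDist_nonneg
  obtain ⟨t, ht, x, hx, hxt⟩ := hbound (min ε ε₀) (lt_min hε hε₀) (min_le_right _ _)
  calc Metric.infDist (y₀ - s • c) A
      ≤ Metric.infDist (y₀ - t • c) A := hmin ht
    _ ≤ dist (y₀ - t • c) x := Metric.infDist_le_dist_of_mem hx
    _ = ‖x - (y₀ - t • c)‖ := by rw [dist_comm, dist_eq_norm]
    _ ≤ 0 + ε := by rw [zero_add]; exact hxt.trans (min_le_left _ _)
end
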